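/- Let p ∈ (0,1), q = 1 − p, and write x_{n,k} = (k − np)/√(npq), Δ_n = 1/√(npq), and f(x) = (1/√(2π))·e^{−x²/2}. Then Σ_{k=0}^{n} |x_{n,k}| · f(x_{n,k}) · Δ_n = Θ(1): there exist an integer N and constants 0 < c₁ ≤ c₂ such that c₁ ≤ Σ_{k=0}^{n} |x_{n,k}| · f(x_{n,k}) · Δ_n ≤ c₂ for every integer n > N. -/

import Mathlib

/-- The discretized Gaussian absolute first moment
`Σ_{k=0}^n |x_{n,k}| f(x_{n,k}) Δ_n` with `x_{n,k} = (k−np)/√(npq)`,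
`Δ_n = 1/√(npq)` and `f` the standard Gaussian density. -/
noncomputable def gaussAbsSum (p : ℝ) (n : ℕ) : ℝ :=
  ∑ k ∈ Finset.range (n + 1),
    |((k : ℝ) - n * p) / Real.sqrt (n * p * (1 - p))| *
      (1 / Real.sqrt (2 * Real.pi) *
        Real.exp (-(((k : ℝ) - n * p) / Real.sqrt (n * p * (1 - p))) ^ 2 / 2)) *
      (1 / Real.sqrt (n * p * (1 - p)))

lemma abs_mul_exp_neg_sq_div_two_le (x : ℝ) :
    |x| * Real.exp (-x ^ 2 / 2) ≤ 16 / (1 + |x|) ^ 2 := by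
  have hx : x ^ 2 = |x| ^ 2 := (sq_abs x).symm
  have hy : 0 ≤ |x| := abs_nonneg x
  rw [hx]
  generalize |x| = y at hy
  have hexp := Real.quadratic_le_exp_of_nonneg (x := y ^ 2 / 2) (by positivity)
  rw [neg_div, Real.exp_neg, le_div_iff₀ (by positivity), mul_right_comm, ← div_eq_mul_inv,
    div_le_iff₀ (Real.exp_pos _)]
  nlinarith [sq_nonneg (y ^ 2 - y), sq_nonneg (y - 1), sq_nonneg y]

/-- The increasing map `x ↦ x / (1 + |x|)` has increments comparable to `(1 + |x|)⁻²`. -/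
lemma div_one_add_abs_sq_le_sub (x d : ℝ) (hd : 0 ≤ d) (hd1 : d ≤ 1) :
    d / (1 + |x|) ^ 2 ≤ 2 * ((x + d) / (1 + |x + d|) - x / (1 + |x|)) := by
  have hu : 0 ≤ |x| := abs_nonneg x
  have hv : 0 ≤ |x + d| := abs_nonneg _
  have hvu : |x + d| ≤ |x| + d := (abs_add_le x d).trans_eq (by rw [abs_of_nonneg hd])
  have hnum : d ≤ (x + d) * (1 + |x|) - (1 + |x + d|) * x := by
    rcases abs_cases x with ⟨h, _⟩ | ⟨h, _⟩ <;> rcases abs_cases (x + d) with ⟨h', _⟩ | ⟨h', _⟩ <;>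
      rw [h, h'] <;> nlinarith
  rw [div_sub_div _ _ (by positivity) (by positivity), ← mul_div_assoc,
    div_le_div_iff₀ (by positivity) (by positivity)]
  calc d * ((1 + |x + d|) * (1 + |x|)) ≤ d * ((2 * (1 + |x|)) * (1 + |x|)) := by
        gcongr; linarith
    _ = 2 * d * (1 + |x|) ^ 2 := by ring
    _ ≤ _ := by gcongr

lemma sum_div_one_add_abs_sq_le (a s : ℝ) (hs : 1 ≤ s) (m : ℕ) :
    ∑ k ∈ Finset.range m, 1 / s / (1 + |((k : ℝ) - a) / s|) ^ 2 ≤ 4 := by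
  have hs0 : 0 < s := by linarith
  set T : ℕ → ℝ := fun k => ((k : ℝ) - a) / s / (1 + |((k : ℝ) - a) / s|) with hT
  have hbound : ∀ k, |T k| ≤ 1 := fun k => by
    have h : 0 < 1 + |((k : ℝ) - a) / s| := by positivity
    rw [hT, abs_div, abs_of_pos h, div_le_one h]
    linarith
  calc ∑ k ∈ Finset.range m, 1 / s / (1 + |((k : ℝ) - a) / s|) ^ 2
      ≤ ∑ k ∈ Finset.range m, 2 * (T (k + 1) - T k) := by
        refine Finset.sum_le_sum fun k _ => ?_
        have h := div_one_add_abs_sq_le_sub (((k : ℝ) - a) / s) (1 / s) (by positivity)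
          ((div_le_one hs0).2 hs)
        rwa [← add_div, show (k : ℝ) - a + 1 = ((k + 1 : ℕ) : ℝ) - a by push_cast; ring] at h
    _ = 2 * (T m - T 0) := by rw [← Finset.mul_sum, Finset.sum_range_sub]
    _ ≤ 4 := by linarith [abs_le.1 (hbound m), abs_le.1 (hbound 0)]

lemma half_le_card_Icc_ceil_floor (a s : ℝ) (ha : 0 ≤ a) (hs : 2 ≤ s) :
    s / 2 ≤ ((Finset.Icc ⌈a + s⌉₊ ⌊a + 2 * s⌋₊).card : ℝ) := by
  have hceil := Nat.ceil_lt_add_one (show 0 ≤ a + s by linarith)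
  have hfloor := Nat.lt_floor_add_one (a + 2 * s)
  have hcard : ((⌊a + 2 * s⌋₊ + 1 : ℕ) : ℝ) ≤
      ((⌊a + 2 * s⌋₊ + 1 - ⌈a + s⌉₊ + ⌈a + s⌉₊ : ℕ) : ℝ) := by
    exact_mod_cast le_tsub_add
  rw [Nat.card_Icc]
  rw [Nat.cast_add, Nat.cast_add] at hcard
  push_cast at hcard ⊢
  linarith

lemma gaussAbsSum_le (p : ℝ) (n : ℕ) (h : 1 ≤ √(n * p * (1 - p))) :
    gaussAbsSum p n ≤ 64 * (1 / √(2 * Real.pi)) := by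
  unfold gaussAbsSum
  set s := √(n * p * (1 - p))
  have hs0 : 0 < s := by linarith
  calc _ ≤ ∑ k ∈ Finset.range (n + 1), 16 * (1 / √(2 * Real.pi)) *
        (1 / s / (1 + |((k : ℝ) - n * p) / s|) ^ 2) := by
        refine Finset.sum_le_sum fun k _ => ?_
        have hk := abs_mul_exp_neg_sq_div_two_le (((k : ℝ) - n * p) / s)
        calc _ = (1 / √(2 * Real.pi) * (1 / s)) * (|((k : ℝ) - n * p) / s| *
              Real.exp (-(((k : ℝ) - n * p) / s) ^ 2 / 2)) := by ring
          _ ≤ (1 / √(2 * Real.pi) * (1 / s)) * (16 / (1 + |((k : ℝ) - n * p) / s|) ^ 2) := by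
              gcongr
          _ = _ := by ring
    _ ≤ 16 * (1 / √(2 * Real.pi)) * 4 := by
        rw [← Finset.mul_sum]
        gcongr
        exact sum_div_one_add_abs_sq_le _ _ h _
    _ = _ := by ring

lemma le_gaussAbsSum (p : ℝ) (hp : 0 < p) (hp1 : p < 1) (n : ℕ) (h : 4 ≤ n * p * (1 - p)) :
    1 / √(2 * Real.pi) * Real.exp (-2) / 2 ≤ gaussAbsSum p n := by
  have hs2 : 2 ≤ √(n * p * (1 - p)) := Real.le_sqrt_of_sq_le (by linarith)
  have hn : (0 : ℝ) ≤ n := n.cast_nonneg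
  have hend : n * p + 2 * √(n * p * (1 - p)) ≤ n := by
    have hq : 4 * p ≤ n * (1 - p) := by nlinarith
    have : √(n * p * (1 - p)) ≤ n * (1 - p) / 2 :=
      Real.sqrt_le_iff.2 ⟨by nlinarith, by nlinarith⟩
    linarith
  unfold gaussAbsSum
  set s := √(n * p * (1 - p))
  have hs0 : 0 < s := by linarith
  have hnp : 0 ≤ n * p := by positivity
  have hsub : Finset.Icc ⌈n * p + s⌉₊ ⌊n * p + 2 * s⌋₊ ⊆ Finset.range (n + 1) := fun k hk => by
    have := (Finset.mem_Icc.1 hk).2.trans (Nat.floor_le_of_le hend)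
    exact Finset.mem_range.2 (by omega)
  refine le_trans ?_ (Finset.sum_le_sum_of_subset_of_nonneg hsub fun k _ _ => by positivity)
  calc 1 / √(2 * Real.pi) * Real.exp (-2) / 2
      = s / 2 * (1 * (1 / √(2 * Real.pi) * Real.exp (-2)) * (1 / s)) := by field_simp
    _ ≤ (Finset.Icc ⌈n * p + s⌉₊ ⌊n * p + 2 * s⌋₊).card *
          (1 * (1 / √(2 * Real.pi) * Real.exp (-2)) * (1 / s)) := by
        gcongr
        exact half_le_card_Icc_ceil_floor _ _ hnp hs2
    _ ≤ _ := by
        rw [← nsmul_eq_mul]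
        refine Finset.card_nsmul_le_sum _ _ _ fun k hk => ?_
        rw [Finset.mem_Icc, Nat.ceil_le, Nat.le_floor_iff (by positivity)] at hk
        have hx1 : 1 ≤ (k - n * p) / s := (one_le_div hs0).2 (by linarith)
        have hx2 : (k - n * p) / s ≤ 2 := (div_le_iff₀ hs0).2 (by linarith)
        gcongr
        · exact hx1.trans (le_abs_self _)
        · nlinarith

/-- `Σ_{k=0}^n |x_{n,k}| f(x_{n,k}) Δ_n = Θ(1)`. -/
theorem gaussAbsSum_theta_one (p : ℝ) (hp : 0 < p) (hp1 : p < 1) :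
    ∃ N : ℕ, ∃ c₁ c₂ : ℝ, 0 < c₁ ∧ c₁ ≤ c₂ ∧ ∀ n : ℕ, N < n →
      c₁ ≤ gaussAbsSum p n ∧ gaussAbsSum p n ≤ c₂ := by
  have hpq : 0 < p * (1 - p) := mul_pos hp (by linarith)
  have hexp : Real.exp (-2) ≤ 1 := Real.exp_le_one_iff.2 (by norm_num)
  have hC : 0 < 1 / √(2 * Real.pi) := by positivity
  refine ⟨⌈4 / (p * (1 - p))⌉₊, 1 / √(2 * Real.pi) * Real.exp (-2) / 2,
    64 * (1 / √(2 * Real.pi)), by positivity, by nlinarith, fun n hn => ?_⟩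
  have h : 4 ≤ n * p * (1 - p) := by
    have := (div_lt_iff₀ hpq).1 (Nat.lt_of_ceil_lt hn)
    linarith
  exact ⟨le_gaussAbsSum p hp hp1 n h, gaussAbsSum_le p n (Real.le_sqrt_of_sq_le (by linarith))⟩
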